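/- Let l ≥ 1 and let the variables x_0, …, x_{n+l−1} of a polynomial ring over ℂ be partitioned into l blocks, the b-th block consisting of n_b + 1 variables, with n = n_1 + ⋯ + n_l. Let m ≥ 1, 1 ≤ k ≤ n, N = ⌈m/k⌉, and let f_1, …, f_m be multihomogeneous polynomials all of the same multidegree d = (d_1, …, d_l) (i.e. each f_j is homogeneous of degree d_b in the variables of the b-th block, for every b), with |d| = d_1 + ⋯ + d_l ≥ 1. Then there exists a nonzero polynomial H in the N·k·m entries of a tuple (Λ^1, …, Λ^N) of k×m complex matrices, of total degree at most N·k·|d|^{k−1} + m, such that whenever H(Λ^1, …, Λ^N) ≠ 0: (a) for each i ∈ [N], every minimal prime over the ideal generated by the k linear combinations Σ_{j=1}^m Λ^i_{sj} f_j (s = 1, …, k) is either a minimal prime over ⟨f_1, …, f_m⟩ or has height exactly k; and (b) the ideal generated by all N·k linear combinations equals ⟨f_1, …, f_m⟩. -/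

import Mathlib

namespace Aux

open MvPolynomial

theorem height_map_C_ge {A : Type*} [CommRing A] (p : Ideal A) [hp : p.IsPrime] :
    p.height ≤ (p.map (Polynomial.C : A →+* Polynomial A)).height := by
  have := Ideal.isPrime_map_C_of_isPrime (P := p)
  let φ : PrimeSpectrum A → PrimeSpectrum (Polynomial A) := fun q =>
    ⟨q.asIdeal.map Polynomial.C, Ideal.isPrime_map_C_of_isPrime⟩
  have hφ : StrictMono φ := by
    apply Monotone.strictMono_of_injective
    · intro a b h
      exact Ideal.map_mono h
    · intro a b h
      have h1 : a.asIdeal.map (Polynomial.C : A →+* Polynomial A) = b.asIdeal.map Polynomial.C :=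
        congrArg PrimeSpectrum.asIdeal h
      ext x
      have h2 := SetLike.ext_iff.1 h1 (Polynomial.C x)
      simp only [Ideal.mem_map_C_iff, Polynomial.coeff_C] at h2
      constructor
      · intro hx
        simpa using h2.1 (fun n => by split_ifs <;> simp [hx]) 0
      · intro hx
        simpa using h2.2 (fun n => by split_ifs <;> simp [hx]) 0
  have h := Order.height_le_height_apply_of_strictMono φ hφ ⟨p, hp⟩
  rwa [← PrimeSpectrum.height_eq_orderHeight, ← PrimeSpectrum.height_eq_orderHeight] at h

theorem exists_indep {K : Type*} [Field K] (σ : Type*) [Finite σ] :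
    ∀ (p : Ideal (MvPolynomial σ K)), p.IsPrime → ∃ S : Finset σ, (S.card : ℕ∞) ≤ p.height ∧
      ∀ g ∈ p, (∀ d ∈ g.support, ∀ i ∈ S, d i = 0) → g = 0 := by
  induction σ using Finite.induction_empty_option with
  | @of_equiv α β e ih =>
    intro p hp
    let E := (renameEquiv K e).toRingEquiv
    obtain ⟨S, hS, h⟩ := ih (p.comap E) (Ideal.comap_isPrime E p)
    refine ⟨S.map e.toEmbedding, ?_, ?_⟩
    · rw [Finset.card_map]
      rwa [RingEquiv.height_comap] at hS
    · intro g hg hd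
      obtain ⟨g', rfl⟩ := E.surjective g
      have : g' = 0 := by
        apply h g' hg
        intro d hd' i hi
        have := hd (Finsupp.mapDomain e d) ?_ (e i) (by simpa using hi)
        · rwa [Finsupp.mapDomain_apply e.injective] at this
        · change _ ∈ (rename e g').support
          rw [mem_support_iff, coeff_rename_mapDomain _ e.injective]
          simpa using hd'
      rw [this, map_zero]
  | h_empty =>
    intro p hp
    refine ⟨∅, by simp, fun g hg _ => ?_⟩
    by_contra hne
    obtain ⟨a, rfl⟩ := (C_surjective (R := K) PEmpty) g
    have ha : a ≠ 0 := by rintro rfl; simp at hne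
    exact hp.ne_top (Ideal.eq_top_of_isUnit_mem _ hg ((isUnit_iff_ne_zero.2 ha).map C))
  | @h_option α _ ih =>
    classical
    intro p hp
    let E := (optionEquivLeft K α).toRingEquiv
    let P := p.comap E.symm
    have hP : P.IsPrime := Ideal.comap_isPrime E.symm p
    have hPh : P.height = p.height := RingEquiv.height_comap E.symm p
    have hmem : ∀ g ∈ p, optionEquivLeft K α g ∈ P := by
      intro g hg
      change E.symm (E g) ∈ p
      simpa using hg
    let p0 := P.comap (Polynomial.C : MvPolynomial α K →+* _)
    have hp0 : p0.IsPrime := Ideal.comap_isPrime _ P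
    obtain ⟨S, hS, h⟩ := ih p0 hp0
    have hle : p0.map Polynomial.C ≤ P := Ideal.map_comap_le
    have hpr := Ideal.isPrime_map_C_of_isPrime (P := p0)
    rcases hle.eq_or_lt with heq | hlt
    · refine ⟨S.map Function.Embedding.some, ?_, ?_⟩
      · rw [Finset.card_map, ← hPh, ← heq]
        exact hS.trans (height_map_C_ge p0)
      · intro g hg hd
        have h1 := hmem g hg
        rw [← heq, Ideal.mem_map_C_iff] at h1
        apply (optionEquivLeft K α).injective
        rw [map_zero]
        ext1 n
        refine h _ (h1 n) ?_
        intro d hd' i hi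
        rw [mem_support_coeff_optionEquivLeft] at hd'
        have := hd _ hd' (some i) (by simpa using hi)
        simpa using this
    · refine ⟨insert none (S.map Function.Embedding.some), ?_, ?_⟩
      · rw [Finset.card_insert_of_notMem (by simp), Finset.card_map, ← hPh]
        push_cast
        refine le_trans ?_ (Ideal.height_add_one_le_of_lt_of_isPrime hlt)
        gcongr
        exact hS.trans (height_map_C_ge p0)
      · intro g hg hd
        have h1 := hmem g hg
        have hdeg : (optionEquivLeft K α g).natDegree = 0 := by
          rw [natDegree_optionEquivLeft, ← Nat.le_zero, degreeOf_le_iff]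
          intro m hm
          exact (hd m hm none (by simp)).le
        rw [Polynomial.eq_C_of_natDegree_eq_zero hdeg] at h1
        apply (optionEquivLeft K α).injective
        rw [map_zero, Polynomial.eq_C_of_natDegree_eq_zero hdeg]
        rw [h _ h1, map_zero]
        intro d hd' i hi
        rw [mem_support_coeff_optionEquivLeft] at hd'
        have := hd _ hd' (some i) (by simpa using hi)
        simpa using this


theorem exists_indep' {σ : Type*} [Finite σ] (p : Ideal (MvPolynomial σ ℂ)) (hp : p.IsPrime) :
    ∃ S : Finset σ, (S.card : ℕ∞) ≤ p.height ∧
      ∀ g ∈ p, g ∈ supported ℂ ((S : Set σ)ᶜ) → g = 0 := by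
  obtain ⟨S, h1, h2⟩ := exists_indep σ p hp
  refine ⟨S, h1, fun g hg hs => h2 g hg ?_⟩
  intro d hd i hi
  by_contra hne
  rw [mem_supported] at hs
  have : i ∈ g.vars := (mem_vars_iff_mem_support i).2 ⟨d, hd, by simpa using hne⟩
  exact hs (Finset.mem_coe.2 this) (by simpa using hi)

theorem lowest_coeff {S : Type*} [CommRing S] (g : Polynomial S)
    (Φ : S →+* Polynomial ℂ) (h : Polynomial.eval₂ Φ Polynomial.X g = 0) :
    (Φ (g.coeff g.natTrailingDegree)).eval 0 = 0 := by
  obtain ⟨g', hg'⟩ : Polynomial.X ^ g.natTrailingDegree ∣ g := by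
    rw [Polynomial.X_pow_dvd_iff]
    intro d hd
    exact Polynomial.coeff_eq_zero_of_lt_natTrailingDegree hd
  have h1 : g.coeff g.natTrailingDegree = g'.coeff 0 := by
    conv_lhs => rw [hg']
    have := Polynomial.coeff_X_pow_mul g' g.natTrailingDegree 0
    rw [zero_add] at this
    rw [← hg'] at this ⊢
    exact this
  rw [h1]
  rw [hg', Polynomial.eval₂_mul, Polynomial.eval₂_X_pow] at h
  have h2 := (mul_eq_zero.1 h).resolve_left (pow_ne_zero _ Polynomial.X_ne_zero)
  have h3 := congrArg (Polynomial.eval 0) h2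
  rw [Polynomial.eval_zero, ← Polynomial.coe_evalRingHom, Polynomial.hom_eval₂] at h3
  simp only [Polynomial.coe_evalRingHom, Polynomial.eval_X] at h3
  rw [Polynomial.eval₂_at_zero] at h3
  simpa using h3

theorem gauss_dvd {A : Type*} [CommRing A] [IsDomain A] [UniqueFactorizationMonoid A]
    (P : Ideal (Polynomial A)) [hP : P.IsPrime] (h0 : ∀ a, Polynomial.C a ∈ P → a = 0)
    (Q F : Polynomial A) (hQ : Irreducible Q) (hQP : Q ∈ P) (hF : F ∈ P) : Q ∣ F := by
  classical
  have : GCDMonoid A := UniqueFactorizationMonoid.toGCDMonoid A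
  let K := FractionRing A
  have hdeg : Q.natDegree ≠ 0 := by
    intro h
    rw [Polynomial.eq_C_of_natDegree_eq_zero h] at hQP
    have := h0 _ hQP
    rw [Polynomial.eq_C_of_natDegree_eq_zero h, this] at hQ
    exact hQ.ne_zero (map_zero _)
  have hprim : Q.IsPrimitive := hQ.isPrimitive hdeg
  have hirr : Irreducible (Q.map (algebraMap A K)) :=
    (hprim.irreducible_iff_irreducible_map_fraction_map (K := K)).1 hQ
  apply hprim.dvd_of_fraction_map_dvd_fraction_map (K := K)
  by_contra hnd
  obtain ⟨a, b, hab⟩ := (hirr.coprime_iff_not_dvd.2 hnd)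
  obtain ⟨d, hd0, hd⟩ := IsLocalization.integerNormalization_spec (nonZeroDivisors A) a
  obtain ⟨e, he0, he⟩ := IsLocalization.integerNormalization_spec (nonZeroDivisors A) b
  set a' := IsLocalization.integerNormalization (nonZeroDivisors A) a
  set b' := IsLocalization.integerNormalization (nonZeroDivisors A) b
  have key : Polynomial.C e * a' * Q + Polynomial.C d * b' * F
      = Polynomial.C (d * e) := by
    apply Polynomial.map_injective (algebraMap A K) (IsFractionRing.injective A K)
    simp only [Polynomial.map_add, Polynomial.map_mul, hd, he, Polynomial.map_C, Algebra.smul_def,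
      map_mul]
    have e1 : ∀ x : A, (algebraMap A (Polynomial K)) x = Polynomial.C (algebraMap A K x) :=
      fun x => rfl
    simp only [e1]
    linear_combination (Polynomial.C (algebraMap A K d) * Polynomial.C (algebraMap A K e)) * hab
  have hmem : Polynomial.C (d * e) ∈ P := by
    rw [← key]
    exact P.add_mem (P.mul_mem_left _ hQP) (P.mul_mem_left _ hF)
  have := h0 _ hmem
  exact mul_ne_zero (nonZeroDivisors.ne_zero hd0) (nonZeroDivisors.ne_zero he0) this

theorem mem_of_vanish {σ : Type*} [Finite σ] (p : Ideal (MvPolynomial σ ℂ)) [hp : p.IsPrime]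
    (g : MvPolynomial σ ℂ)
    (h : ∀ w : σ → ℂ, (∀ q ∈ p, eval w q = 0) → eval w g = 0) : g ∈ p := by
  have h1 := vanishingIdeal_zeroLocus_eq_radical (K := ℂ) p
  rw [hp.radical] at h1
  rw [← h1, mem_vanishingIdeal_iff]
  intro w hw
  exact h w hw

theorem exists_zero {k : ℕ} (E : Fin k → MvPolynomial (Fin (k + 1)) ℂ)
    (hE : ∀ s, eval 0 (E s) = 0) : ∃ y : Fin (k + 1) → ℂ, y ≠ 0 ∧ ∀ s, eval y (E s) = 0 := by
  let m0 : Ideal (MvPolynomial (Fin (k + 1)) ℂ) := RingHom.ker (eval 0)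
  have hm0 : m0.IsPrime := RingHom.ker_isPrime _
  let J := Ideal.span (Set.range E)
  have hJ : J ≤ m0 := by
    rw [Ideal.span_le]
    rintro _ ⟨s, rfl⟩
    exact hE s
  obtain ⟨q, hq, hqm⟩ := Ideal.exists_minimalPrimes_le hJ
  have hqp : q.IsPrime := hq.isPrime
  have hh : q.height ≤ k := by
    refine (Ideal.height_le_spanRank_toENat_of_mem_minimalPrimes J q hq).trans ?_
    have : J.spanRank ≤ k := by
      refine (Submodule.spanRank_span_le_card _).trans ?_
      refine Cardinal.mk_range_le.trans ?_
      simp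
    simpa using Cardinal.toENat.monotone' this
  by_contra hno
  push Not at hno
  have hmq : m0 ≤ q := by
    intro g hg
    apply mem_of_vanish q
    intro w hw
    have : w = 0 := by
      by_contra hne
      obtain ⟨s, hs⟩ := hno w hne
      exact hs (hw _ (hq.le (Ideal.subset_span ⟨s, rfl⟩)))
    rw [this]; exact hg
  have heq : q = m0 := le_antisymm hqm hmq
  obtain ⟨S, hS, h⟩ := exists_indep' q hqp
  have hSu : S = Finset.univ := by
    rw [Finset.eq_univ_iff_forall]
    intro i
    by_contra hi
    have := h (X i) (by rw [heq]; simp [m0, RingHom.mem_ker]) (by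
      rw [X_mem_supported]; simpa using hi)
    exact X_ne_zero i this
  rw [hSu, Finset.card_univ, Fintype.card_fin] at hS
  have h3 := hS.trans hh
  norm_cast at h3
  omega


theorem generic_section {σ : Type*} [Fintype σ] (k : ℕ) (p : Ideal (MvPolynomial σ ℂ))
    [hp : p.IsPrime] (hk : p.height < k) (f : MvPolynomial σ ℂ) (hf : f ∉ p)
    (h : MvPolynomial (σ × Fin k) ℂ) (hh : h ≠ 0) :
    ∃ (u : σ × Fin k → ℂ) (y : Fin k → ℂ), y ≠ 0 ∧
      (∀ g ∈ p, eval (fun i => ∑ s, u (i, s) * y s) g = 0) ∧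
      eval (fun i => ∑ s, u (i, s) * y s) f ≠ 0 ∧ eval u h ≠ 0 := by
  classical
  obtain ⟨S, hS, hind⟩ := exists_indep' p hp
  have hcard : S.card < k := by
    have := hS.trans_lt hk
    exact_mod_cast this
  obtain ⟨k', rfl⟩ : ∃ k', k = k' + 1 := ⟨k - 1, by omega⟩
  by_contra hno
  push Not at hno
  -- an injection of `S` into the columns
  obtain ⟨ι⟩ : Nonempty (S ↪ Fin k') :=
    Function.Embedding.nonempty_of_card_le (by simp; omega)
  let e : σ → Fin k' → ℂ := fun i s => if hi : i ∈ S then (if ι ⟨i, hi⟩ = s then 1 else 0) else 0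
  let γ : MvPolynomial (σ × Fin (k' + 1)) ℂ →ₐ[ℂ]
      Polynomial (MvPolynomial (σ × Fin (k' + 1)) ℂ) :=
    aeval (fun v => Fin.cases (Polynomial.C (X (v.1, 0)))
      (fun s => Polynomial.C (C (e v.1 s)) + Polynomial.X * Polynomial.C (X (v.1, s.succ))) v.2)
  have hγ : γ h ≠ 0 := by
    obtain ⟨u0, hu0⟩ : ∃ u0, eval u0 h ≠ 0 := by
      by_contra hc
      push Not at hc
      exact hh (MvPolynomial.funext fun x => by rw [hc x, map_zero])
    intro hz
    let z : σ × Fin (k' + 1) → ℂ := fun v =>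
      Fin.cases (u0 (v.1, 0)) (fun s => u0 (v.1, s.succ) - e v.1 s) v.2
    have h1 : ∀ g, Polynomial.eval₂ (eval z) 1 (γ g) = eval u0 g := by
      intro g
      have : ((Polynomial.eval₂RingHom (eval z) 1).comp (γ : _ →+* _)) = eval u0 := by
        apply MvPolynomial.ringHom_ext
        · intro a
          simp [γ, Polynomial.algebraMap_apply]
        · rintro ⟨i, s⟩
          induction s using Fin.cases <;> simp [γ, z]
      exact RingHom.congr_fun this g
    apply hu0
    rw [← h1, hz, Polynomial.eval₂_zero]
  set hn := (γ h).coeff (γ h).natTrailingDegree with hhn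
  have hn0 : hn ≠ 0 := by
    rw [hhn]
    exact Polynomial.trailingCoeff_nonzero_iff_nonzero.2 hγ
  apply hn0
  apply MvPolynomial.funext
  intro z
  rw [map_zero]
  let τ : σ × Fin (k' + 1) → MvPolynomial σ ℂ := fun v =>
    Fin.cases (if v.1 ∈ S then C (z (v.1, 0)) else X v.1) (fun s => C (z (v.1, s.succ))) v.2
  let ρ : MvPolynomial σ ℂ := aeval τ hn
  have hρS : ρ ∈ supported ℂ ((S : Set σ)ᶜ) := by
    have h1 : ρ ∈ Algebra.adjoin ℂ (Set.range τ) := by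
      rw [Algebra.adjoin_range_eq_range_aeval]
      exact ⟨hn, rfl⟩
    refine (Algebra.adjoin_le ?_) h1
    rintro _ ⟨⟨i, s⟩, rfl⟩
    induction s using Fin.cases with
    | zero =>
      by_cases hi : i ∈ S
      · simp only [τ, Fin.cases_zero, hi, if_true]
        exact Subalgebra.algebraMap_mem _ _
      · simp only [τ, Fin.cases_zero, hi, if_false]
        exact X_mem_supported.2 (by simpa using hi)
    | succ s =>
      simp only [τ, Fin.cases_succ]
      exact Subalgebra.algebraMap_mem _ _
  have hρp : ρ * f ∈ p := by
    apply mem_of_vanish p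
    intro w hw
    rw [map_mul]
    by_cases hfw : eval w f = 0
    · rw [hfw, mul_zero]
    suffices hs : eval w ρ = 0 by rw [hs, zero_mul]
    -- the coefficients `q`
    let q : Fin k' → ℂ := Function.extend ι (fun i => w i.1 - z (i.1, 0)) 0
    have hq : ∀ i (hi : i ∈ S), q (ι ⟨i, hi⟩) = w i - z (i, 0) := by
      intro i hi
      exact ι.injective.extend_apply _ _ _
    have hqe : ∀ i, ∑ s, q s * e i s = if i ∈ S then w i - z (i, 0) else 0 := by
      intro i
      by_cases hi : i ∈ S
      · simp only [e, hi, dif_pos, if_true]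
        simp [hq i hi]
      · simp [e, hi]
    let Φ : MvPolynomial (σ × Fin (k' + 1)) ℂ →+* Polynomial ℂ :=
      (aeval (R := ℂ) (fun v : σ × Fin (k' + 1) => (Fin.cases
        (Polynomial.C (w v.1 - ∑ s, q s * e v.1 s)
          - Polynomial.X * Polynomial.C (∑ s, q s * z (v.1, Fin.succ s)))
        (fun s => Polynomial.C (z (v.1, Fin.succ s))) v.2 : Polynomial ℂ))).toRingHom
    have hΦ : Polynomial.eval₂ Φ Polynomial.X (γ h) = 0 := by
      apply Polynomial.funext
      intro ε
      rw [Polynomial.eval_zero]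
      let u : σ × Fin (k' + 1) → ℂ := fun v =>
        Fin.cases (w v.1 - ∑ s, q s * e v.1 s - ε * ∑ s, q s * z (v.1, Fin.succ s))
          (fun s => e v.1 s + ε * z (v.1, Fin.succ s)) v.2
      have h1 : ∀ g, (Polynomial.eval₂ Φ Polynomial.X (γ g)).eval ε = eval u g := by
        intro g
        have : (Polynomial.evalRingHom ε).comp
            ((Polynomial.eval₂RingHom Φ Polynomial.X).comp (γ : _ →+* _)) = eval u := by
          apply MvPolynomial.ringHom_ext
          · intro a
            simp [γ, Polynomial.algebraMap_apply, Φ]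
          · rintro ⟨i, s⟩
            induction s using Fin.cases with
            | zero => simp [γ, u, Φ, Polynomial.eval_finsetSum]
            | succ s =>
              simp [γ, u, Φ]
              ring
        exact RingHom.congr_fun this g
      rw [h1]
      have huy : (fun i => ∑ s, u (i, s) * (Fin.cons 1 q : Fin (k' + 1) → ℂ) s) = w := by
        funext i
        rw [Fin.sum_univ_succ]
        simp only [u, Fin.cases_zero, Fin.cases_succ, Fin.cons_zero, Fin.cons_succ, add_mul,
          Finset.sum_add_distrib, Finset.mul_sum]
        have e1 : ∑ s, e i s * q s = ∑ s, q s * e i s :=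
          Finset.sum_congr rfl fun _ _ => mul_comm _ _
        have e2 : ∑ s, ε * z (i, Fin.succ s) * q s = ∑ s, ε * (q s * z (i, Fin.succ s)) :=
          Finset.sum_congr rfl fun _ _ => by ring
        rw [e1, e2]
        ring
      refine hno u (Fin.cons 1 q) ?_ ?_ ?_
      · intro h0
        have := congrFun h0 0
        simp at this
      · rw [huy]; exact hw
      · rw [huy]; exact hfw
    have h2 := lowest_coeff (γ h) Φ hΦ
    rw [← hhn] at h2
    rw [← h2]
    have h3 : ∀ g, eval w (aeval τ g) = (Φ g).eval 0 := by
      intro g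
      have : (eval w).comp (aeval τ : _ →ₐ[ℂ] MvPolynomial σ ℂ).toRingHom =
          (Polynomial.evalRingHom 0).comp Φ := by
        apply MvPolynomial.ringHom_ext
        · intro a
          simp [Φ]
        · rintro ⟨i, s⟩
          induction s using Fin.cases with
          | zero =>
            by_cases hi : i ∈ S <;> simp [Φ, τ, hqe, hi]
          | succ s => simp [Φ, τ]
      exact RingHom.congr_fun this g
    exact h3 hn
  have hρ : ρ = 0 := hind ρ ((hp.mem_or_mem hρp).resolve_right hf) hρS
  have h4 : ∀ g, eval (fun i => z (i, 0)) (aeval τ g) = eval z g := by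
    intro g
    have : (eval (fun i => z (i, 0))).comp (aeval τ : _ →ₐ[ℂ] MvPolynomial σ ℂ).toRingHom =
        eval z := by
      apply MvPolynomial.ringHom_ext
      · intro a
        simp
      · rintro ⟨i, s⟩
        induction s using Fin.cases with
        | zero =>
          by_cases hi : i ∈ S <;> simp [τ, hi]
        | succ s => simp [τ]
    exact RingHom.congr_fun this g
  rw [← h4]
  change eval _ ρ = 0
  rw [hρ, map_zero]


/-- Exponent vectors of degree `D` in `k` variables. -/
abbrev Mon (k D : ℕ) := {α : Fin k → ℕ // α ∈ Finset.piAntidiag (Finset.univ : Finset (Fin k)) D}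

theorem Mon.sum {k D : ℕ} (α : Mon k D) : ∑ i, α.1 i = D := (Finset.mem_piAntidiag.1 α.2).1

/-- Build an exponent vector. -/
def Mon.mk' {k D : ℕ} (a : Fin k → ℕ) (h : ∑ i, a i = D) : Mon k D :=
  ⟨a, Finset.mem_piAntidiag.2 ⟨h, fun _ _ => Finset.mem_univ _⟩⟩

/-- The pure power exponent. -/
def Mon.pure {k : ℕ} (D : ℕ) (s : Fin k) : Mon k D := Mon.mk' (Pi.single s D) (by simp)

/-- The standard coefficient system `y_s ^ D`. -/
def c0 (R : Type*) [CommRing R] (k D : ℕ) : Fin k × Mon k D → R :=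
  fun v => if v.2 = Mon.pure D v.1 then 1 else 0

theorem exists_choice (k D : ℕ) (s0 : Fin k) :
    ∃ (ch : Mon k (k * (D - 1) + 1) → Fin k) (rest : Mon k (k * (D - 1) + 1) → Fin k → ℕ),
      (∀ β, β.1 = rest β + Pi.single (ch β) D) ∧
      ∀ β, ch β = s0 → ∀ i, i ≠ s0 → β.1 i < D := by
  have key : ∀ β : Mon k (k * (D - 1) + 1), ∃ s : Fin k, D ≤ β.1 s ∧
      (s = s0 → ∀ i, i ≠ s0 → β.1 i < D) := by
    intro β
    by_cases h : ∃ i, i ≠ s0 ∧ D ≤ β.1 i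
    · obtain ⟨i, hi, hD⟩ := h
      exact ⟨i, hD, fun h => absurd h hi⟩
    · push Not at h
      refine ⟨s0, ?_, fun _ => h⟩
      by_contra hlt
      have : ∀ i, β.1 i ≤ D - 1 := by
        intro i
        by_cases hi : i = s0
        · subst hi; omega
        · have := h i hi; omega
      have h2 : ∑ i, β.1 i ≤ ∑ _i : Fin k, (D - 1) := Finset.sum_le_sum fun i _ => this i
      rw [β.sum] at h2
      simp at h2
  choose ch h1 h2 using key
  refine ⟨ch, fun β => β.1 - Pi.single (ch β) D, ?_, h2⟩
  intro β
  funext i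
  have := h1 β
  by_cases hi : i = ch β
  · subst hi
    simp; omega
  · simp [hi]

/-- Macaulay type matrix. -/
def macMat {R : Type*} [CommRing R] {k D δ : ℕ} (ch : Mon k δ → Fin k) (rest : Mon k δ → Fin k → ℕ)
    (c : Fin k × Mon k D → R) : Matrix (Mon k δ) (Mon k δ) R :=
  fun β γ => ∑ α : Mon k D, if γ.1 = rest β + α.1 then c (ch β, α) else 0

theorem macMat_map {R R' : Type*} [CommRing R] [CommRing R'] {k D δ : ℕ} (ch : Mon k δ → Fin k)
    (rest : Mon k δ → Fin k → ℕ)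
    (c : Fin k × Mon k D → R) (φ : R →+* R') :
    φ (macMat ch rest c).det = (macMat ch rest (fun v => φ (c v))).det := by
  rw [RingHom.map_det]
  congr 1
  ext β γ
  simp only [macMat, RingHom.mapMatrix_apply, Matrix.map_apply, map_sum]
  refine Finset.sum_congr rfl fun α _ => ?_
  split_ifs <;> simp

theorem macMat_c0 {R : Type*} [CommRing R] {k D δ : ℕ} (ch : Mon k δ → Fin k)
    (rest : Mon k δ → Fin k → ℕ) (hr : ∀ β, β.1 = rest β + Pi.single (ch β) D) :
    (macMat ch rest (c0 R k D)).det = 1 := by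
  rw [show macMat ch rest (c0 R k D) = 1 from ?_, Matrix.det_one]
  ext β γ
  simp only [macMat, c0]
  rw [Finset.sum_eq_single (Mon.pure D (ch β))]
  · have : (γ.1 = rest β + (Mon.pure D (ch β)).1) ↔ β = γ := by
      change γ.1 = rest β + Pi.single (ch β) D ↔ _
      rw [← hr β, Subtype.ext_iff]
      exact eq_comm
    simp [this, Matrix.one_apply]
  · intro α _ h
    simp [h]
  · simp

theorem macMat_zero {R : Type*} [CommRing R] [IsDomain R] {k D δ : ℕ} (ch : Mon k δ → Fin k)
    (rest : Mon k δ → Fin k → ℕ) (hr : ∀ β, β.1 = rest β + Pi.single (ch β) D)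
    (c : Fin k × Mon k D → R) (y : Fin k → R) (hy : y ≠ 0)
    (hc : ∀ s, ∑ α : Mon k D, c (s, α) * ∏ i, y i ^ α.1 i = 0) :
    (macMat ch rest c).det = 0 := by
  classical
  rw [← Matrix.exists_mulVec_eq_zero_iff]
  refine ⟨fun γ => ∏ i, y i ^ γ.1 i, ?_, ?_⟩
  · intro h
    obtain ⟨i, hi⟩ := Function.ne_iff.1 hy
    have := congrFun h (Mon.pure δ i)
    simp only [Mon.pure, Mon.mk', Pi.zero_apply] at this
    rw [Finset.prod_eq_single i] at this
    · rw [Pi.single_eq_same] at this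
      exact hi (by by_contra h0; exact pow_ne_zero δ h0 this)
    · intro j _ hj; simp [hj]
    · simp
  · funext β
    simp only [Matrix.mulVec, dotProduct, macMat, Pi.zero_apply, Finset.sum_mul]
    rw [Finset.sum_comm]
    have : ∀ α : Mon k D, ∑ γ : Mon k δ, (if γ.1 = rest β + α.1 then c (ch β, α) else 0) *
        ∏ i, y i ^ γ.1 i = (∏ i, y i ^ rest β i) * (c (ch β, α) * ∏ i, y i ^ α.1 i) := by
      intro α
      have hs : ∑ i, (rest β + α.1) i = δ := by
        have h1 := β.sum
        rw [hr β] at h1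
        simp only [Pi.add_apply, Finset.sum_add_distrib, α.sum, Finset.sum_pi_single',
          Finset.mem_univ, if_true] at h1 ⊢
        exact h1
      rw [Finset.sum_eq_single (Mon.mk' _ hs)]
      · simp only [Mon.mk', if_true, Pi.add_apply, pow_add, Finset.prod_mul_distrib]
        ring
      · intro γ _ hγ
        rw [if_neg, zero_mul]
        intro h
        exact hγ (Subtype.ext h)
      · simp
    rw [Finset.sum_congr rfl fun α _ => this α, ← Finset.mul_sum, hc, mul_zero]

theorem card_choice (k D δ : ℕ) (s0 : Fin k) (ch : Mon k δ → Fin k)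
    (h : ∀ β, ch β = s0 → ∀ i, i ≠ s0 → β.1 i < D) :
    (Finset.univ.filter fun β => ch β = s0).card ≤ D ^ (k - 1) := by
  have h1 : Fintype.card ({i // i ≠ s0} → Fin D) = D ^ (k - 1) := by
    simp [Fintype.card_subtype_compl]
  rw [← h1, ← Fintype.card_coe]
  refine Fintype.card_le_of_injective
    (fun β i => ⟨β.1.1 i.1, h β.1 (Finset.mem_filter.1 β.2).2 i.1 i.2⟩) ?_
  intro β β' hb
  have h2 : ∀ i, i ≠ s0 → β.1.1 i = β'.1.1 i := by
    intro i hi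
    have := congrFun hb ⟨i, hi⟩
    simpa using this
  apply Subtype.ext
  apply Subtype.ext
  funext i
  by_cases hi : i = s0
  · subst hi
    have e1 := β.1.sum
    have e2 := β'.1.sum
    rw [← Finset.add_sum_erase _ _ (Finset.mem_univ i)] at e1 e2
    have e3 : ∑ j ∈ Finset.univ.erase i, β.1.1 j = ∑ j ∈ Finset.univ.erase i, β'.1.1 j :=
      Finset.sum_congr rfl fun j hj => h2 j (Finset.ne_of_mem_erase hj)
    change _ + ∑ j ∈ Finset.univ.erase i, β.1.1 j = _ at e1
    change _ + ∑ j ∈ Finset.univ.erase i, β'.1.1 j = _ at e2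
    omega
  · exact h2 i hi

/-- Grading by the degree in the block `s` of variables. -/
noncomputable def psi {k D : ℕ} (s : Fin k) : MvPolynomial (Fin k × Mon k D) ℂ →ₐ[ℂ]
    Polynomial (MvPolynomial (Fin k × Mon k D) ℂ) :=
  aeval fun v => if v.1 = s then Polynomial.X * Polynomial.C (X v) else Polynomial.C (X v)

theorem psi_monomial {k D : ℕ} (s : Fin k) (m : Fin k × Mon k D →₀ ℕ) (a : ℂ) :
    psi s (monomial m a) = Polynomial.X ^ (∑ α, m (s, α)) * Polynomial.C (monomial m a) := by
  classical
  rw [psi, aeval_monomial]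
  rw [Finsupp.prod_fintype _ _ (by simp)]
  have : ∀ v : Fin k × Mon k D, (if v.1 = s then Polynomial.X * Polynomial.C (X v : MvPolynomial (Fin k × Mon k D) ℂ)
      else Polynomial.C (X v)) ^ m v =
      Polynomial.X ^ (if v.1 = s then m v else 0) * Polynomial.C (X v) ^ m v := by
    intro v
    split_ifs
    · rw [mul_pow]
    · simp
  rw [Finset.prod_congr rfl fun v _ => this v, Finset.prod_mul_distrib, Finset.prod_pow_eq_pow_sum]
  have h1 : (∑ v : Fin k × Mon k D, if v.1 = s then m v else 0) = ∑ α, m (s, α) := by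
    rw [Fintype.sum_prod_type, Finset.sum_eq_single s]
    · simp
    · intro b _ hb; simp [hb]
    · simp
  rw [h1, monomial_eq, Finsupp.prod_fintype _ _ (by simp)]
  simp only [map_mul, map_prod, map_pow]
  rw [show (algebraMap ℂ (Polynomial (MvPolynomial (Fin k × Mon k D) ℂ))) a =
    Polynomial.C (C a) from rfl]
  ring

theorem psi_coeff {k D : ℕ} (s : Fin k) (q : MvPolynomial (Fin k × Mon k D) ℂ)
    (m : Fin k × Mon k D →₀ ℕ) :
    ((psi s q).coeff (∑ α, m (s, α))).coeff m = q.coeff m := by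
  classical
  induction q using MvPolynomial.induction_on' with
  | monomial u a =>
    rw [psi_monomial, Polynomial.coeff_X_pow_mul', Polynomial.coeff_C, coeff_monomial]
    by_cases h : u = m
    · subst h; simp
    · split_ifs <;> simp [coeff_monomial, h]
  | add p q hp hq => rw [map_add, Polynomial.coeff_add, coeff_add, coeff_add, hp, hq]

theorem psi_injective {k D : ℕ} (s : Fin k) : Function.Injective (psi (D := D) s) := by
  intro p q h
  ext m
  rw [← psi_coeff s p, ← psi_coeff s q, h]

theorem totalDegree_le_psi {k D : ℕ} (q : MvPolynomial (Fin k × Mon k D) ℂ) (n : ℕ)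
    (h : ∀ s, (psi s q).natDegree ≤ n) : q.totalDegree ≤ k * n := by
  rw [totalDegree, Finset.sup_le_iff]
  intro m hm
  rw [Finsupp.sum_fintype _ _ (by simp), Fintype.sum_prod_type]
  refine (Finset.sum_le_card_nsmul _ _ n fun s _ => ?_).trans (by simp)
  refine le_trans ?_ (h s)
  apply Polynomial.le_natDegree_of_ne_zero
  intro h0
  have := psi_coeff s q m
  rw [h0, coeff_zero] at this
  exact (mem_support_iff.1 hm) this.symm

theorem natDegree_det_le {n : Type*} [Fintype n] [DecidableEq n] {R : Type*} [CommRing R]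
    (M : Matrix n n (Polynomial R)) (r : n → ℕ) (h : ∀ i j, (M i j).natDegree ≤ r i) :
    M.det.natDegree ≤ ∑ i, r i := by
  rw [Matrix.det_apply]
  apply Polynomial.natDegree_sum_le_of_forall_le
  intro σ _
  refine (Polynomial.natDegree_smul_le _ _).trans ?_
  refine (Polynomial.natDegree_prod_le _ _).trans ?_
  rw [← Equiv.sum_comp σ r]
  exact Finset.sum_le_sum fun i _ => h _ _

theorem psi_mac {k D δ : ℕ} (s0 : Fin k) (ch : Mon k δ → Fin k)
    (rest : Mon k δ → Fin k → ℕ)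
    (h : ∀ β, ch β = s0 → ∀ i, i ≠ s0 → β.1 i < D) :
    (psi s0 (macMat ch rest (X : Fin k × Mon k D → MvPolynomial _ ℂ)).det).natDegree
      ≤ D ^ (k - 1) := by
  have := macMat_map ch rest (X : Fin k × Mon k D → MvPolynomial _ ℂ) (psi (D := D) s0).toRingHom
  change psi s0 _ = _ at this
  rw [this]
  refine le_trans ?_ (card_choice k D δ s0 ch h)
  refine (natDegree_det_le _ (fun β => if ch β = s0 then 1 else 0) ?_).trans ?_
  · intro β γ
    apply Polynomial.natDegree_sum_le_of_forall_le
    intro α _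
    change Polynomial.natDegree (if γ.1 = rest β + α.1 then psi s0 (X (ch β, α)) else 0) ≤ _
    split_ifs <;> simp [psi, *]
  · simp


theorem indep_v0 {k D : ℕ} (hD : 1 ≤ D) (s0 : Fin (k + 1))
    (F : MvPolynomial (Fin (k + 1) × Mon (k + 1) D) ℂ)
    (hF : ∀ (c : Fin (k + 1) × Mon (k + 1) D → ℂ) (y : Fin (k + 1) → ℂ), y ≠ 0 →
      (∀ s, ∑ α : Mon (k + 1) D, c (s, α) * ∏ i, y i ^ α.1 i = 0) → eval c F = 0)
    (hv : ∀ c t, eval (Function.update c (s0, Mon.pure D s0) t) F = eval c F) : F = 0 := by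
  obtain ⟨ch, rest, hr, -⟩ := exists_choice (k + 1) D s0
  let ct : Fin (k + 1) × Mon (k + 1) D → MvPolynomial (Fin (k + 1) × Mon (k + 1) D) ℂ :=
    fun v => if v.1 = s0 then C (c0 ℂ (k + 1) D v) else X v
  let Z := (macMat ch rest ct).det
  have hZe : ∀ c, eval c Z = (macMat ch rest
      (fun v => if v.1 = s0 then (c0 ℂ (k + 1) D v) else c v)).det := by
    intro c
    rw [macMat_map]
    congr 2
    funext v
    simp only [ct]
    split_ifs <;> simp
  have hZ : Z ≠ 0 := by
    intro h
    have h1 := hZe (c0 ℂ (k + 1) D)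
    simp only [ite_self] at h1
    rw [macMat_c0 ch rest hr, h, map_zero] at h1
    exact zero_ne_one h1
  have hFZ : F * Z = 0 := by
    apply MvPolynomial.funext
    intro c
    rw [map_mul, map_zero]
    by_cases hc : eval c Z = 0
    · rw [hc, mul_zero]
    rw [hZe] at hc
    obtain ⟨y, hy, hE⟩ := exists_zero (fun s : Fin k => ∑ α : Mon (k + 1) D,
      C (c (s0.succAbove s, α)) * ∏ i, (X i : MvPolynomial (Fin (k + 1)) ℂ) ^ α.1 i) (by
        intro s
        rw [map_sum]
        refine Finset.sum_eq_zero fun α _ => ?_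
        have : ∃ i, α.1 i ≠ 0 := by
          by_contra hcon
          push Not at hcon
          have := α.sum
          simp only [hcon, Finset.sum_const_zero] at this
          omega
        obtain ⟨i, hi⟩ := this
        rw [map_mul, map_prod, Finset.prod_eq_zero (Finset.mem_univ i), mul_zero]
        simp [hi])
    have hE' : ∀ s, s ≠ s0 → ∑ α : Mon (k + 1) D, c (s, α) * ∏ i, y i ^ α.1 i = 0 := by
      intro s hs
      obtain ⟨s', rfl⟩ := Fin.exists_succAbove_eq hs
      have := hE s'
      rw [map_sum] at this
      rw [← this]
      exact Finset.sum_congr rfl fun α _ => by simp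
    have hpure : ∏ i, y i ^ (Mon.pure D s0).1 i = y s0 ^ D := by
      rw [Finset.prod_eq_single s0]
      · simp [Mon.pure, Mon.mk']
      · intro j _ hj; simp [Mon.pure, Mon.mk', hj]
      · simp
    have hy0 : y s0 ≠ 0 := by
      intro h0
      apply hc
      apply macMat_zero ch rest hr _ y hy
      intro s
      by_cases hs : s = s0
      · subst hs
        simp only [if_true]
        rw [Finset.sum_eq_single (Mon.pure D s)]
        · rw [hpure, h0, zero_pow (by omega), mul_zero]
        · intro α _ hα
          simp [c0, hα]
        · simp
      · simp only [hs, if_false]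
        exact hE' s hs
    let T := ∑ α : Mon (k + 1) D, c (s0, α) * ∏ i, y i ^ α.1 i
    let t := c (s0, Mon.pure D s0) - T / y s0 ^ D
    have hz := hF (Function.update c (s0, Mon.pure D s0) t) y hy (by
      intro s
      by_cases hs : s = s0
      · subst hs
        have h1 : ∀ α : Mon (k + 1) D, Function.update c (s, Mon.pure D s) t (s, α) *
            ∏ i, y i ^ α.1 i = c (s, α) * ∏ i, y i ^ α.1 i -
              if α = Mon.pure D s then T else 0 := by
          intro α
          by_cases hα : α = Mon.pure D s
          · subst hα
            rw [Function.update_self, hpure, if_pos rfl]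
            simp only [t]
            field_simp
          · rw [Function.update_of_ne (by simpa using hα), if_neg hα, sub_zero]
        rw [Finset.sum_congr rfl fun α _ => h1 α, Finset.sum_sub_distrib,
          Finset.sum_ite_eq' Finset.univ, if_pos (Finset.mem_univ _)]
        exact sub_self _
      · rw [← hE' s hs]
        refine Finset.sum_congr rfl fun α _ => ?_
        rw [Function.update_of_ne (by simp [hs])])
    rw [hv] at hz
    rw [hz, zero_mul]
  exact (mul_eq_zero.1 hFZ).resolve_right hZ

/-- Generic point of the incidence variety. -/
noncomputable def kap (k D : ℕ) : MvPolynomial (Fin k × Mon k D) ℂ →ₐ[ℂ]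
    MvPolynomial (Fin k ⊕ (Fin k × Mon k D × Mon k D)) ℂ :=
  aeval fun v => ∑ α' : Mon k D, (X (Sum.inr (v.1, v.2, α')) - X (Sum.inr (v.1, α', v.2))) *
    ∏ i, X (Sum.inl i) ^ α'.1 i

theorem mac_mem {k D δ : ℕ} (hk : 1 ≤ k) (ch : Mon k δ → Fin k)
    (rest : Mon k δ → Fin k → ℕ) (hr : ∀ β, β.1 = rest β + Pi.single (ch β) D) :
    kap k D (macMat ch rest (X : Fin k × Mon k D → MvPolynomial _ ℂ)).det = 0 := by
  have := macMat_map ch rest (X : Fin k × Mon k D → MvPolynomial _ ℂ) (kap k D).toRingHom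
  change kap k D _ = _ at this
  rw [this]
  refine macMat_zero ch rest hr _ (fun i => X (Sum.inl i)) ?_ ?_
  · intro h
    exact X_ne_zero _ (congrFun h ⟨0, hk⟩)
  · intro s
    change ∑ α : Mon k D, kap k D (X (s, α)) * _ = 0
    simp only [kap, aeval_X, Finset.sum_mul, sub_mul, Finset.sum_sub_distrib]
    rw [sub_eq_zero]
    rw [Finset.sum_comm]
    refine Finset.sum_congr rfl fun α _ => Finset.sum_congr rfl fun α' _ => ?_
    ring

theorem kap_vanish {k D : ℕ} (F : MvPolynomial (Fin k × Mon k D) ℂ) (hF : kap k D F = 0)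
    (c : Fin k × Mon k D → ℂ) (y : Fin k → ℂ) (hy : y ≠ 0)
    (hc : ∀ s, ∑ α : Mon k D, c (s, α) * ∏ i, y i ^ α.1 i = 0) : eval c F = 0 := by
  obtain ⟨i0, hi0⟩ := Function.ne_iff.1 hy
  let α0 := Mon.pure D i0
  let mo : Mon k D → ℂ := fun α => ∏ i, y i ^ α.1 i
  have hpure : mo α0 = y i0 ^ D := by
    simp only [mo, α0]
    rw [Finset.prod_eq_single i0]
    · simp [Mon.pure, Mon.mk']
    · intro j _ hj; simp [Mon.pure, Mon.mk', hj]
    · simp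
  have h0 : mo α0 ≠ 0 := by rw [hpure]; exact pow_ne_zero _ hi0
  let a : Fin k × Mon k D × Mon k D → ℂ := fun q => if q.2.2 = α0 then c (q.1, q.2.1) / mo α0 else 0
  have key : (eval (Sum.elim y a)).comp (kap k D).toRingHom = eval c := by
    apply MvPolynomial.ringHom_ext
    · intro r
      simp [kap]
    · rintro ⟨s, α⟩
      have h1 : (eval (Sum.elim y a)) (kap k D (X (s, α))) =
          ∑ α' : Mon k D, (a (s, α, α') - a (s, α', α)) * mo α' := by
        simp only [kap, aeval_X, map_sum, map_mul, map_sub, eval_X, map_prod, map_pow,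
          Sum.elim_inl, Sum.elim_inr, mo]
      change (eval (Sum.elim y a)) (kap k D (X (s, α))) = _
      rw [h1, eval_X]
      simp only [sub_mul, Finset.sum_sub_distrib, a]
      have h2 : ∑ α' : Mon k D, (if α' = α0 then c (s, α) / mo α0 else 0) * mo α' = c (s, α) := by
        rw [Finset.sum_eq_single α0]
        · rw [if_pos rfl]; field_simp
        · intro b _ hb; rw [if_neg hb, zero_mul]
        · simp
      have h3 : ∑ α' : Mon k D, (if α = α0 then c (s, α') / mo α0 else 0) * mo α' = 0 := by
        split_ifs
        · have : ∀ α' : Mon k D, c (s, α') / mo α0 * mo α' = (c (s, α') * mo α') / mo α0 := by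
            intro α'; ring
          rw [Finset.sum_congr rfl fun α' _ => this α', ← Finset.sum_div]
          simp only [mo]
          rw [hc s, zero_div]
        · simp
      rw [h2, h3, sub_zero]
  rw [← key]
  change eval _ (kap k D F) = 0
  rw [hF, map_zero]

theorem resultant (k D : ℕ) (hk : 1 ≤ k) (hD : 1 ≤ D) :
    ∃ Q : MvPolynomial (Fin k × Mon k D) ℂ, Q.totalDegree ≤ k * D ^ (k - 1) ∧
      eval (c0 ℂ k D) Q ≠ 0 ∧
      ∀ (c : Fin k × Mon k D → ℂ) (y : Fin k → ℂ), y ≠ 0 →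
        (∀ s, ∑ α : Mon k D, c (s, α) * ∏ i, y i ^ α.1 i = 0) → eval c Q = 0 := by
  classical
  obtain ⟨k, rfl⟩ : ∃ k', k = k' + 1 := ⟨k - 1, by omega⟩
  choose ch rest hr hch using exists_choice (k + 1) D
  let R : Fin (k + 1) → MvPolynomial (Fin (k + 1) × Mon (k + 1) D) ℂ := fun s =>
    (macMat (ch s) (rest s) (X : Fin (k + 1) × Mon (k + 1) D → MvPolynomial _ ℂ)).det
  let P : Ideal (MvPolynomial (Fin (k + 1) × Mon (k + 1) D) ℂ) :=
    RingHom.ker (kap (k + 1) D).toRingHom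
  have hP : P.IsPrime := RingHom.ker_isPrime _
  have hRP : ∀ s, R s ∈ P := fun s => mac_mem hk (ch s) (rest s) (hr s)
  have hR1 : ∀ s, eval (c0 ℂ (k + 1) D) (R s) = 1 := by
    intro s
    rw [macMat_map]
    simp only [eval_X]
    exact macMat_c0 _ _ (hr s)
  have hR0 : ∀ s, R s ≠ 0 := by
    intro s h
    have := hR1 s
    rw [h, map_zero] at this
    exact zero_ne_one this
  obtain ⟨fs, hfs, hass⟩ := WfDvdMonoid.exists_factors (R 0) (hR0 0)
  have hprod : fs.prod ∈ P := by
    obtain ⟨u, hu⟩ := hass.symm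
    rw [← hu]
    exact P.mul_mem_right _ (hRP 0)
  obtain ⟨Q, hQf, hQP⟩ := (hP.multiset_prod_mem_iff_exists_mem fs).1 hprod
  have hQ := hfs Q hQf
  let v0 : Fin (k + 1) × Mon (k + 1) D := (0, Mon.pure D 0)
  let e : MvPolynomial (Fin (k + 1) × Mon (k + 1) D) ℂ ≃ₐ[ℂ]
      Polynomial (MvPolynomial {v // v ≠ v0} ℂ) :=
    (renameEquiv ℂ (Equiv.optionSubtypeNe v0).symm).trans (optionEquivLeft ℂ _)
  have heC : ∀ a : MvPolynomial {v // v ≠ v0} ℂ, e.symm (Polynomial.C a) = rename Subtype.val a := by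
    intro a
    rw [AlgEquiv.symm_apply_eq]
    have : (e : _ →ₐ[ℂ] _).comp (rename (Subtype.val : {v // v ≠ v0} → _)) =
        (Polynomial.CAlgHom (R := MvPolynomial {v // v ≠ v0} ℂ)).restrictScalars ℂ := by
      apply MvPolynomial.algHom_ext
      intro i
      simp [e, optionEquivLeft_X_some, i.2]
    exact (AlgHom.congr_fun this a).symm
  have hdvd : ∀ s, Q ∣ R s := by
    intro s
    have hP' : (P.comap e.symm.toRingEquiv.toRingHom).IsPrime := Ideal.comap_isPrime _ _
    have := gauss_dvd (P.comap e.symm.toRingEquiv.toRingHom) ?_ (e Q) (e (R s))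
      ((MulEquiv.irreducible_iff e).2 hQ) ?_ ?_
    · exact (map_dvd_iff e).1 this
    · intro a ha
      have ha' : e.symm (Polynomial.C a) ∈ P := ha
      rw [heC] at ha'
      have h0 := indep_v0 hD 0 (rename Subtype.val a) (fun c y hy hc => kap_vanish _ ha' c y hy hc)
        (by
          intro c t
          rw [eval_rename, eval_rename]
          congr 2
          funext i
          exact Function.update_of_ne i.2 _ _)
      exact rename_injective _ Subtype.val_injective (h0.trans (map_zero _).symm)
    · change e.symm (e Q) ∈ P
      simpa using hQP
    · change e.symm (e (R s)) ∈ P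
      simpa using hRP s
  refine ⟨Q, ?_, ?_, fun c y hy hc => kap_vanish Q hQP c y hy hc⟩
  · apply totalDegree_le_psi
    intro s
    refine le_trans (Polynomial.natDegree_le_of_dvd (map_dvd (psi s) (hdvd s)) ?_)
      (psi_mac s (ch s) (rest s) (hch s))
    intro h
    exact hR0 s (psi_injective s (h.trans (map_zero _).symm))
  · intro h
    obtain ⟨G, hG⟩ := hdvd 0
    have := hR1 0
    rw [hG, map_mul, h, zero_mul] at this
    exact zero_ne_one this


theorem sect_coeff {σ : Type*} [Fintype σ] (k D : ℕ) (f : MvPolynomial σ ℂ)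
    (hf : f.IsHomogeneous D) :
    ∃ a : Mon k D → MvPolynomial (σ × Fin k) ℂ, ∀ (u : σ × Fin k → ℂ) (y : Fin k → ℂ),
      ∑ α : Mon k D, eval u (a α) * ∏ i, y i ^ α.1 i = eval (fun i => ∑ s, u (i, s) * y s) f := by
  classical
  let L : σ → MvPolynomial (Fin k) (MvPolynomial (σ × Fin k) ℂ) := fun i =>
    ∑ s, C (X (i, s)) * X s
  let F := aeval (R := ℂ) L f
  have hF : F.IsHomogeneous D := by
    have := hf.aeval L (n := 1) (by
      intro i
      apply IsHomogeneous.sum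
      intro s _
      have := (isHomogeneous_C (Fin k) (X (i, s) : MvPolynomial (σ × Fin k) ℂ)).mul
        (isHomogeneous_X (MvPolynomial (σ × Fin k) ℂ) s)
      simpa using this)
    simpa using this
  refine ⟨fun α => F.coeff (Finsupp.equivFunOnFinite.symm α.1), fun u y => ?_⟩
  have h1 : eval₂ (eval u) y F = eval (fun i => ∑ s, u (i, s) * y s) f := by
    have : (eval₂Hom (eval u) y).comp (aeval (R := ℂ) L).toRingHom =
        eval (fun i => ∑ s, u (i, s) * y s) := by
      apply MvPolynomial.ringHom_ext
      · intro r
        simp [MvPolynomial.algebraMap_apply]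
      · intro i
        simp [L]
    exact RingHom.congr_fun this f
  rw [← h1, eval₂_eq']
  symm
  refine Finset.sum_bij_ne_zero (fun d hd h => Mon.mk' d ?_) ?_ ?_ ?_ ?_
  · have := hF (mem_support_iff.1 hd)
    rw [Finsupp.weight_apply, Finsupp.sum_fintype _ _ (by simp)] at this
    simpa using this
  · intros; exact Finset.mem_univ _
  · intro d hd h d' hd' h' he
    exact DFunLike.coe_injective (congrArg Subtype.val he)
  · intro α _ hα
    refine ⟨Finsupp.equivFunOnFinite.symm α.1, ?_, ?_, ?_⟩
    · rw [mem_support_iff]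
      intro h0
      apply hα
      simp only [h0, map_zero, zero_mul]
    · exact hα
    · rfl
  · intro d hd h
    have : d = Finsupp.equivFunOnFinite.symm (d : Fin k → ℕ) := by
      ext i; rfl
    simp only [Mon.mk']
    rw [← this]

/-- Coefficientwise total degree bound. -/
def CoefBd {V τ : Type*} (n : ℕ) (g : Polynomial (MvPolynomial τ (MvPolynomial V ℂ))) : Prop :=
  ∀ i β, ((g.coeff i).coeff β).totalDegree ≤ n

theorem CoefBd.mono {V τ : Type*} {n n' : ℕ} {g : Polynomial (MvPolynomial τ (MvPolynomial V ℂ))}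
    (h : CoefBd n g) (hn : n ≤ n') : CoefBd n' g := fun i β => (h i β).trans hn

theorem CoefBd.mul {V τ : Type*} {n n' : ℕ} {g g' : Polynomial (MvPolynomial τ (MvPolynomial V ℂ))}
    (h : CoefBd n g) (h' : CoefBd n' g') : CoefBd (n + n') (g * g') := by
  classical
  intro i β
  rw [Polynomial.coeff_mul, coeff_sum]
  apply totalDegree_finsetSum_le
  intro p _
  rw [coeff_mul]
  apply totalDegree_finsetSum_le
  intro q _
  exact (totalDegree_mul _ _).trans (add_le_add (h _ _) (h' _ _))

theorem CoefBd.add {V τ : Type*} {n : ℕ} {g g' : Polynomial (MvPolynomial τ (MvPolynomial V ℂ))}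
    (h : CoefBd n g) (h' : CoefBd n g') : CoefBd n (g + g') := by
  intro i β
  rw [Polynomial.coeff_add, coeff_add]
  exact (totalDegree_add _ _).trans (max_le (h _ _) (h' _ _))

theorem CoefBd.sum {V τ ι : Type*} {n : ℕ} (s : Finset ι)
    (g : ι → Polynomial (MvPolynomial τ (MvPolynomial V ℂ)))
    (h : ∀ i ∈ s, CoefBd n (g i)) : CoefBd n (∑ i ∈ s, g i) := by
  classical
  induction s using Finset.induction_on with
  | empty => intro i β; simp
  | insert a s ha ih =>
    rw [Finset.sum_insert ha]
    exact (h a (by simp)).add (ih fun i hi => h i (by simp [hi]))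

theorem CoefBd.C {V τ : Type*} {n : ℕ} {x : MvPolynomial τ (MvPolynomial V ℂ)}
    (h : ∀ β, (x.coeff β).totalDegree ≤ n) : CoefBd n (Polynomial.C x) := by
  intro i β
  rw [Polynomial.coeff_C]
  split_ifs
  · exact h β
  · simp

theorem CoefBd.X {V τ : Type*} :
    CoefBd 0 (Polynomial.X : Polynomial (MvPolynomial τ (MvPolynomial V ℂ))) := by
  classical
  intro i β
  rw [Polynomial.coeff_X]
  split_ifs
  · rw [coeff_one]; split_ifs <;> simp
  · simp

theorem CoefBd.one {V τ : Type*} :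
    CoefBd 0 (1 : Polynomial (MvPolynomial τ (MvPolynomial V ℂ))) := by
  classical
  rw [← Polynomial.C_1]
  apply CoefBd.C
  intro β
  rw [coeff_one]; split_ifs <;> simp

theorem CoefBd.pow {V τ : Type*} {n : ℕ} {g : Polynomial (MvPolynomial τ (MvPolynomial V ℂ))}
    (h : CoefBd n g) (e : ℕ) : CoefBd (e * n) (g ^ e) := by
  induction e with
  | zero => rw [pow_zero, zero_mul]; exact CoefBd.one
  | succ e ih => rw [pow_succ, Nat.succ_mul]; exact ih.mul h

theorem CoefBd.prod {V τ ι : Type*} (s : Finset ι) (n : ι → ℕ)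
    (g : ι → Polynomial (MvPolynomial τ (MvPolynomial V ℂ)))
    (h : ∀ i ∈ s, CoefBd (n i) (g i)) : CoefBd (∑ i ∈ s, n i) (∏ i ∈ s, g i) := by
  classical
  induction s using Finset.induction_on with
  | empty => simpa using CoefBd.one
  | insert a s ha ih =>
    rw [Finset.prod_insert ha, Finset.sum_insert ha]
    exact (h a (by simp)).mul (ih fun i hi => h i (by simp [hi]))

theorem CoefBd.aeval {V τ ι : Type*} (q : MvPolynomial ι ℂ)
    (g : ι → Polynomial (MvPolynomial τ (MvPolynomial V ℂ)))
    (h : ∀ i, CoefBd 1 (g i)) : CoefBd q.totalDegree (MvPolynomial.aeval (R := ℂ) g q) := by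
  classical
  rw [aeval_def, eval₂_eq]
  apply CoefBd.sum
  intro d hd
  have h1 : CoefBd 0 (algebraMap ℂ (Polynomial (MvPolynomial τ (MvPolynomial V ℂ)))
      (q.coeff d)) := by
    change CoefBd 0 (Polynomial.C (MvPolynomial.C (MvPolynomial.C _)))
    apply CoefBd.C
    intro β
    rw [coeff_C]; split_ifs <;> simp
  refine (h1.mul (CoefBd.prod d.support (fun i => d i * 1) _ fun i _ => (h i).pow (d i))).mono ?_
  rw [zero_add]
  simp only [mul_one]
  exact le_totalDegree hd

theorem per_matrix {σ : Type*} [Fintype σ] (k m D : ℕ) (hk : 1 ≤ k) (hD : 1 ≤ D)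
    (f : Fin m → MvPolynomial σ ℂ) (hf : ∀ j, (f j).IsHomogeneous D) :
    ∃ H : MvPolynomial (Fin k × Fin m) ℂ, H ≠ 0 ∧ H.totalDegree ≤ k * D ^ (k - 1) ∧
      ∀ Λ : Fin k → Fin m → ℂ, eval (fun v : Fin k × Fin m => Λ v.1 v.2) H ≠ 0 →
        ∀ p : Ideal (MvPolynomial σ ℂ), p.IsPrime → (∀ s, ∑ j, Λ s j • f j ∈ p) →
          p.height < k → ∀ j, f j ∈ p := by
  classical
  obtain ⟨Q, hQd, hQ0, hQ⟩ := resultant k D hk hD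
  choose a ha using fun j => sect_coeff k D (f j) (hf j)
  let θg : Fin k × Mon k D →
      Polynomial (MvPolynomial (σ × Fin k) (MvPolynomial (Fin k × Fin m) ℂ)) := fun v =>
    Polynomial.C (∑ j, C (X (v.1, j)) * map C (a j v.2)) +
      if v.2 = Mon.pure D v.1 then Polynomial.X else 0
  let θ := aeval (R := ℂ) θg
  have hθ0 : θ Q ≠ 0 := by
    intro h
    have key : (Polynomial.eval₂RingHom
        (eval₂Hom (eval (0 : Fin k × Fin m → ℂ)) (0 : σ × Fin k → ℂ)) 1).comp θ.toRingHom =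
        eval (c0 ℂ k D) := by
      apply MvPolynomial.ringHom_ext
      · intro r
        simp [θ, Polynomial.algebraMap_apply, MvPolynomial.algebraMap_apply]
      · intro v
        change Polynomial.eval₂ _ _ (θ (X v)) = _
        simp only [θ, aeval_X, θg, c0, eval_X, Polynomial.eval₂_add, Polynomial.eval₂_C]
        split_ifs <;> simp
    apply hQ0
    rw [← key]
    change Polynomial.eval₂ _ _ (θ Q) = _
    rw [h, Polynomial.eval₂_zero]
  have hbd : CoefBd Q.totalDegree (θ Q) := by
    apply CoefBd.aeval
    intro v
    apply CoefBd.add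
    · apply CoefBd.C
      intro β
      rw [coeff_sum]
      apply totalDegree_finsetSum_le
      intro j _
      rw [coeff_C_mul, coeff_map]
      refine (totalDegree_mul _ _).trans ?_
      rw [totalDegree_X, totalDegree_C]
    · split_ifs
      · exact CoefBd.X.mono (by simp)
      · intro i β; simp
  let h := (θ Q).coeff (θ Q).natTrailingDegree
  have hh0 : h ≠ 0 := by
    have := (Polynomial.trailingCoeff_nonzero_iff_nonzero (p := θ Q)).2 hθ0
    exact this
  obtain ⟨β, hβ⟩ := MvPolynomial.ne_zero_iff.1 hh0
  refine ⟨h.coeff β, hβ, (hbd _ _).trans hQd, ?_⟩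
  intro Λ hΛ p hp hg hht j
  by_contra hfj
  have hne : map (eval (fun v : Fin k × Fin m => Λ v.1 v.2)) h ≠ 0 := by
    intro h0
    apply hΛ
    rw [← coeff_map, h0, coeff_zero]
  obtain ⟨u, y, hy, hpy, hfy, hhu⟩ := generic_section k p hht (f j) hfj _ hne
  apply hhu
  let x : σ → ℂ := fun i => ∑ s, u (i, s) * y s
  let v : Fin m → ℂ := fun j' => if j' = j then (eval x (f j))⁻¹ else 0
  have hv : ∑ j', v j' * eval x (f j') = 1 := by
    rw [Finset.sum_eq_single j]
    · simp only [v, if_true]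
      exact inv_mul_cancel₀ hfy
    · intro b _ hb
      simp [v, hb]
    · simp
  have hgx : ∀ s, ∑ j', Λ s j' * eval x (f j') = 0 := by
    intro s
    have := hpy _ (hg s)
    rw [map_sum] at this
    simpa [smul_eval] using this
  let ΦB : MvPolynomial (Fin k × Fin m) ℂ →+* Polynomial ℂ :=
    (aeval (R := ℂ) fun q : Fin k × Fin m => Polynomial.C (Λ q.1 q.2) -
      Polynomial.X * Polynomial.C (y q.1 ^ D * v q.2)).toRingHom
  let Φ : MvPolynomial (σ × Fin k) (MvPolynomial (Fin k × Fin m) ℂ) →+* Polynomial ℂ :=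
    eval₂Hom ΦB (fun q => Polynomial.C (u q))
  have hΦ : Polynomial.eval₂ Φ Polynomial.X (θ Q) = 0 := by
    apply Polynomial.funext
    intro t
    rw [Polynomial.eval_zero]
    let c : Fin k × Mon k D → ℂ := fun w =>
      ∑ j', (Λ w.1 j' - t * (y w.1 ^ D * v j')) * eval u (a j' w.2) +
        if w.2 = Mon.pure D w.1 then t else 0
    have key : (Polynomial.evalRingHom t).comp ((Polynomial.eval₂RingHom Φ Polynomial.X).comp
        θ.toRingHom) = eval c := by
      apply MvPolynomial.ringHom_ext
      · intro r
        simp [θ, Polynomial.algebraMap_apply, MvPolynomial.algebraMap_apply, Φ, ΦB]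
      · intro w
        have hmap : ∀ b : MvPolynomial (σ × Fin k) ℂ,
            Φ (map C b) = Polynomial.C (eval u b) := by
          intro b
          have : Φ.comp (map C) = Polynomial.C.comp (eval u) := by
            apply MvPolynomial.ringHom_ext
            · intro r
              simp [Φ, ΦB]
            · intro i
              simp [Φ]
          exact RingHom.congr_fun this b
        have hX : ∀ q, Φ (C (X q)) = Polynomial.C (Λ q.1 q.2) -
            Polynomial.X * Polynomial.C (y q.1 ^ D * v q.2) := by
          intro q
          simp [Φ, ΦB]
        change (Polynomial.eval₂ Φ Polynomial.X (θ (X w))).eval t = eval c (X w)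
        simp only [θ, aeval_X, θg, eval_X, Polynomial.eval₂_add, Polynomial.eval₂_C,
          Polynomial.eval_add, c]
        congr 1
        · rw [map_sum, Polynomial.eval_finsetSum]
          refine Finset.sum_congr rfl fun j' _ => ?_
          rw [map_mul, hmap, hX]
          simp
        · split_ifs <;> simp
    have e1 : (Polynomial.eval₂ Φ Polynomial.X (θ Q)).eval t = eval c Q := RingHom.congr_fun key Q
    rw [e1]
    apply hQ c y hy
    intro s
    have hpure : ∏ i, y i ^ (Mon.pure D s).1 i = y s ^ D := by
      rw [Finset.prod_eq_single s]
      · simp [Mon.pure, Mon.mk']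
      · intro j _ hj; simp [Mon.pure, Mon.mk', hj]
      · simp
    simp only [c, add_mul, Finset.sum_add_distrib, Finset.sum_mul]
    rw [Finset.sum_comm]
    have e2 : ∀ j', ∑ α : Mon k D, (Λ s j' - t * (y s ^ D * v j')) * eval u (a j' α) *
        ∏ i, y i ^ α.1 i = Λ s j' * eval x (f j') - t * y s ^ D * (v j' * eval x (f j')) := by
      intro j'
      simp only [mul_assoc (_ - _), ← Finset.mul_sum]
      rw [ha j' u y]
      ring
    have e3 : ∑ α : Mon k D, (if α = Mon.pure D s then t else 0) * ∏ i, y i ^ α.1 i =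
        t * y s ^ D := by
      rw [Finset.sum_eq_single (Mon.pure D s)]
      · rw [if_pos rfl, hpure]
      · intro b _ hb; rw [if_neg hb, zero_mul]
      · simp
    rw [Finset.sum_congr rfl fun j' _ => e2 j', e3, Finset.sum_sub_distrib, hgx,
      ← Finset.mul_sum, hv]
    ring
  have hl := lowest_coeff (θ Q) Φ hΦ
  change (Φ h).eval 0 = 0 at hl
  rw [← hl]
  have key : (eval u).comp (map (eval (fun v : Fin k × Fin m => Λ v.1 v.2))) =
      (Polynomial.evalRingHom 0).comp Φ := by
    apply MvPolynomial.ringHom_ext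
    · intro b
      have : (eval (fun v : Fin k × Fin m => Λ v.1 v.2)) =
          (Polynomial.evalRingHom 0).comp ΦB := by
        apply MvPolynomial.ringHom_ext
        · intro r; simp [ΦB]
        · intro q; simp [ΦB]
      have := RingHom.congr_fun this b
      simpa [Φ] using this
    · intro q
      simp [Φ]
  exact RingHom.congr_fun key h


theorem homogeneous_of_multi (l : ℕ) (nb : Fin l → ℕ) (d : Fin l → ℕ)
    (f : MvPolynomial ((b : Fin l) × Fin (nb b + 1)) ℂ)
    (hf : ∀ b : Fin l,
      MvPolynomial.IsWeightedHomogeneous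
        (fun v : (b : Fin l) × Fin (nb b + 1) => if v.1 = b then 1 else 0) f (d b)) :
    f.IsHomogeneous (∑ b, d b) := by
  intro m hm
  rw [← Finset.sum_congr rfl fun b _ => hf b hm]
  simp only [Finsupp.weight_apply, Finsupp.sum]
  rw [Finset.sum_comm]
  refine Finset.sum_congr rfl fun v _ => ?_
  simp

theorem det_poly (m : ℕ) {ι : Type*} (e : Fin m ↪ ι) :
    ∃ H : MvPolynomial (ι × Fin m) ℂ, H ≠ 0 ∧ H.totalDegree ≤ m ∧
      ∀ Λ : ι → Fin m → ℂ, eval (fun v : ι × Fin m => Λ v.1 v.2) H =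
        (Matrix.of fun r j : Fin m => Λ (e r) j).det := by
  classical
  have key : ∀ Λ : ι → Fin m → ℂ, eval (fun v : ι × Fin m => Λ v.1 v.2)
      (Matrix.of fun r j : Fin m => (X (e r, j) : MvPolynomial (ι × Fin m) ℂ)).det =
        (Matrix.of fun r j : Fin m => Λ (e r) j).det := by
    intro Λ
    rw [RingHom.map_det]
    congr 1
    ext r j
    simp
  refine ⟨_, ?_, ?_, key⟩
  · intro h
    have := key (fun q j => if e j = q then 1 else 0)
    rw [h, map_zero] at this
    have h1 : (Matrix.of fun r j : Fin m => if e j = e r then (1 : ℂ) else 0) = 1 := by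
      ext r j
      simp [Matrix.one_apply, eq_comm]
    rw [h1, Matrix.det_one] at this
    exact zero_ne_one this
  · rw [Matrix.det_apply]
    apply totalDegree_finsetSum_le
    intro σ _
    refine (totalDegree_smul_le _ _).trans ?_
    refine (totalDegree_finsetProd _ _).trans ?_
    simp [totalDegree_X]

theorem span_eq_of_det {A : Type*} [CommRing A] [Algebra ℂ A] (m : ℕ) {ι : Type*} (e : Fin m ↪ ι)
    (f : Fin m → A) (Λ : ι → Fin m → ℂ)
    (h : (Matrix.of fun r j : Fin m => Λ (e r) j).det ≠ 0) :
    Ideal.span (Set.range fun q : ι => ∑ j : Fin m, Λ q j • f j) = Ideal.span (Set.range f) := by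
  classical
  apply le_antisymm
  · rw [Ideal.span_le]
    rintro _ ⟨q, rfl⟩
    refine Ideal.sum_mem _ fun j _ => ?_
    exact Submodule.smul_of_tower_mem _ _ (Ideal.subset_span ⟨j, rfl⟩)
  · rw [Ideal.span_le]
    rintro _ ⟨j, rfl⟩
    let M : Matrix (Fin m) (Fin m) ℂ := Matrix.of fun r j : Fin m => Λ (e r) j
    have hM : M⁻¹ * M = 1 := Matrix.nonsing_inv_mul _ (isUnit_iff_ne_zero.2 h)
    have : f j = ∑ r, M⁻¹ j r • ∑ j', Λ (e r) j' • f j' := by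
      simp only [Finset.smul_sum, smul_smul]
      rw [Finset.sum_comm]
      have h1 : ∀ j', ∑ r, (M⁻¹ j r * Λ (e r) j') • f j' = ((1 : Matrix (Fin m) (Fin m) ℂ) j j') • f j' := by
        intro j'
        rw [← Finset.sum_smul, ← hM, Matrix.mul_apply]
        rfl
      rw [Finset.sum_congr rfl fun j' _ => h1 j']
      simp [Matrix.one_apply]
    rw [this]
    refine Ideal.sum_mem _ fun r _ => ?_
    exact Submodule.smul_of_tower_mem _ _ (Ideal.subset_span ⟨e r, rfl⟩)

theorem main_aux
    (l m k N : ℕ) (nb : Fin l → ℕ) (d : Fin l → ℕ)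
    (hk1 : 1 ≤ k)
    (hd : 1 ≤ ∑ b : Fin l, d b) (hN : N = (m + k - 1) / k)
    (f : Fin m → MvPolynomial ((b : Fin l) × Fin (nb b + 1)) ℂ)
    (hf : ∀ j : Fin m, ∀ b : Fin l,
      MvPolynomial.IsWeightedHomogeneous
        (fun v : (b : Fin l) × Fin (nb b + 1) => if v.1 = b then 1 else 0)
        (f j) (d b)) :
    ∃ H : MvPolynomial (Fin N × Fin k × Fin m) ℂ, H ≠ 0 ∧
      H.totalDegree ≤ N * k * (∑ b : Fin l, d b) ^ (k - 1) + m ∧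
      ∀ Λ : Fin N → Fin k → Fin m → ℂ,
        MvPolynomial.eval (fun p : Fin N × Fin k × Fin m => Λ p.1 p.2.1 p.2.2) H ≠ 0 →
        ((∀ i : Fin N,
          ∀ p ∈ (Ideal.span
              (Set.range fun s : Fin k => ∑ j : Fin m, Λ i s j • f j)).minimalPrimes,
            p ∈ (Ideal.span (Set.range f)).minimalPrimes ∨
            ∃ hp : p.IsPrime,
              Order.height (⟨p, hp⟩ :
                PrimeSpectrum
                  (MvPolynomial ((b : Fin l) × Fin (nb b + 1)) ℂ)) = (k : ℕ∞)) ∧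
        Ideal.span
            (Set.range fun q : Fin N × Fin k =>
              ∑ j : Fin m, Λ q.1 q.2 j • f j) =
          Ideal.span (Set.range f)) := by
  classical
  obtain ⟨H1, h10, h1d, h1⟩ := per_matrix k m _ hk1 hd f
    (fun j => homogeneous_of_multi l nb d (f j) (hf j))
  have hcard : m ≤ Fintype.card (Fin N × Fin k) := by
    simp only [Fintype.card_prod, Fintype.card_fin]
    have := Nat.lt_div_mul_add (a := m + k - 1) hk1
    rw [← hN] at this
    omega
  obtain ⟨e⟩ : Nonempty (Fin m ↪ Fin N × Fin k) :=
    Function.Embedding.nonempty_of_card_le (by simpa using hcard)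
  obtain ⟨H2, h20, h2d, h2⟩ := det_poly m e
  let H2' := rename (Equiv.prodAssoc (Fin N) (Fin k) (Fin m)) H2
  have hinj : ∀ i : Fin N, Function.Injective (fun q : Fin k × Fin m => (i, q)) :=
    fun i q q' h => (Prod.ext_iff.1 h).2
  refine ⟨H2' * ∏ i : Fin N, rename (fun q : Fin k × Fin m => (i, q)) H1, ?_, ?_, ?_⟩
  · refine mul_ne_zero ?_ (Finset.prod_ne_zero_iff.2 fun i _ => ?_)
    · intro h
      exact h20 (rename_injective _ (Equiv.injective _) (h.trans (map_zero _).symm))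
    · intro h
      exact h10 (rename_injective _ (hinj i) (h.trans (map_zero _).symm))
  · refine (totalDegree_mul _ _).trans ?_
    rw [add_comm]
    refine add_le_add ?_ ((totalDegree_rename_le _ _).trans h2d)
    refine (totalDegree_finsetProd _ _).trans ?_
    refine (Finset.sum_le_card_nsmul _ _ _ fun i _ =>
      (totalDegree_rename_le _ _).trans h1d).trans ?_
    simp [mul_assoc]
  · intro Λ hΛ
    rw [map_mul, map_prod] at hΛ
    have hΛ2 := left_ne_zero_of_mul hΛ
    have hΛ1 := fun i => Finset.prod_ne_zero_iff.1 (right_ne_zero_of_mul hΛ) i (Finset.mem_univ i)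
    refine ⟨fun i p hp => ?_, ?_⟩
    · have hpp : p.IsPrime := hp.isPrime
      have hH := hΛ1 i
      rw [eval_rename] at hH
      have hmem : ∀ s, ∑ j, Λ i s j • f j ∈ p := fun s => hp.le (Ideal.subset_span ⟨s, rfl⟩)
      have hle : Ideal.span (Set.range fun s : Fin k => ∑ j : Fin m, Λ i s j • f j) ≤
          Ideal.span (Set.range f) := by
        rw [Ideal.span_le]
        rintro _ ⟨q, rfl⟩
        refine Ideal.sum_mem _ fun j _ => ?_
        exact Submodule.smul_of_tower_mem _ _ (Ideal.subset_span ⟨j, rfl⟩)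
      by_cases hfp : ∀ j, f j ∈ p
      · left
        have hfp' : Ideal.span (Set.range f) ≤ p := by
          rw [Ideal.span_le]
          rintro _ ⟨j, rfl⟩
          exact hfp j
        exact ⟨⟨hpp, hfp'⟩, fun q hq hqp => hp.2 ⟨hq.1, hle.trans hq.2⟩ hqp⟩
      · right
        refine ⟨hpp, ?_⟩
        rw [← PrimeSpectrum.height_eq_orderHeight]
        apply le_antisymm
        · refine (Ideal.height_le_spanRank_toENat_of_mem_minimalPrimes _ p hp).trans ?_
          have := Submodule.spanRank_span_le_card (R := MvPolynomial ((b : Fin l) × Fin (nb b + 1)) ℂ)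
            (Set.range fun s : Fin k => ∑ j : Fin m, Λ i s j • f j)
          have h3 := Cardinal.toENat.monotone' (this.trans Cardinal.mk_range_le)
          simpa using h3
        · by_contra hlt
          exact hfp (h1 (Λ i) hH p hpp hmem (not_le.1 hlt))
    · apply span_eq_of_det m e f (fun q => Λ q.1 q.2)
      rw [← h2 (fun q => Λ q.1 q.2)]
      intro h0
      apply hΛ2
      rw [eval_rename, ← h0]
      rfl

end Aux

/-- Multihomogeneous version of Statement 10. The variables are
partitioned into `l` blocks, block `b` having `n_b + 1` variables; the `f_j` are
multihomogeneous of the same multidegree `d = (d_1, …, d_l)` (homogeneous of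
degree `d_b` in the variables of block `b`), with `|d| ≥ 1`. Then there is a
nonzero polynomial `H` of degree at most `N·k·|d|^(k−1) + m` in the entries of a
tuple of `N = ⌈m/k⌉` matrices of size `k×m` such that whenever `H` does not
vanish: (a) every minimal prime over the ideal of each system of `k` linear
combinations is either a minimal prime over `⟨f_1, …, f_m⟩` or has height
exactly `k`; and (b) all `N·k` combinations generate `⟨f_1, …, f_m⟩`. -/
theorem generic_linear_combinations_multihomogeneous
    (l m k N : ℕ) (nb : Fin l → ℕ) (d : Fin l → ℕ)
    (hl : 1 ≤ l) (hm : 1 ≤ m) (hk1 : 1 ≤ k) (hkn : k ≤ ∑ b : Fin l, nb b)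
    (hd : 1 ≤ ∑ b : Fin l, d b) (hN : N = (m + k - 1) / k)
    (f : Fin m → MvPolynomial ((b : Fin l) × Fin (nb b + 1)) ℂ)
    (hf : ∀ j : Fin m, ∀ b : Fin l,
      MvPolynomial.IsWeightedHomogeneous
        (fun v : (b : Fin l) × Fin (nb b + 1) => if v.1 = b then 1 else 0)
        (f j) (d b)) :
    ∃ H : MvPolynomial (Fin N × Fin k × Fin m) ℂ, H ≠ 0 ∧
      H.totalDegree ≤ N * k * (∑ b : Fin l, d b) ^ (k - 1) + m ∧
      ∀ Λ : Fin N → Fin k → Fin m → ℂ,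
        MvPolynomial.eval (fun p : Fin N × Fin k × Fin m => Λ p.1 p.2.1 p.2.2) H ≠ 0 →
        ((∀ i : Fin N,
          ∀ p ∈ (Ideal.span
              (Set.range fun s : Fin k => ∑ j : Fin m, Λ i s j • f j)).minimalPrimes,
            p ∈ (Ideal.span (Set.range f)).minimalPrimes ∨
            ∃ hp : p.IsPrime,
              Order.height (⟨p, hp⟩ :
                PrimeSpectrum
                  (MvPolynomial ((b : Fin l) × Fin (nb b + 1)) ℂ)) = (k : ℕ∞)) ∧
        Ideal.span
            (Set.range fun q : Fin N × Fin k =>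
              ∑ j : Fin m, Λ q.1 q.2 j • f j) =
          Ideal.span (Set.range f)) := by
  exact Aux.main_aux l m k N nb d hk1 hd hN f hf
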